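/- arXiv:2012.05632 — 2 statements merged into one kernel-verified Lean document; each statement's English description precedes it below -/
import Mathlib

section
/- Let N, T be positive integers, let Γ ∈ ℝ^{N×N} be symmetric strictly positive definite, let β, τ, g, ε > 0 and set ρ = max_{i,j} |(Γ⁻¹ Γ⁻¹)_{i,j}|. Let K = {W ∈ ℝ^{N×N} : W symmetric strictly positive definite, max_{i,j} |W_{i,j}| ≤ β, and Tr(Γ W Γ) ≤ τ} and 𝓛 = {L ∈ ℝ^{N×N} : L symmetric positive semidefinite and ∑_{i,j} |L_{i,j}| ≤ g}. Set η = √(τ / (g² (β + ρε)² ε T)). Suppose L_1, …, L_T ∈ 𝓛 and W_1, …, W_T ∈ K are such that for each t ∈ [T], W_t minimises the function W ↦ −ln det(Γ W Γ + ε E) + η ∑_{s=1}^{t−1} L_s • W over K. Then for every W* ∈ K, ∑_{t=1}^{T} (W_t − W*) • L_t ≤ (1 + 1152 √e) · g (β + ρε) √(τ T / ε). -/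
open Finset Matrix

/-- Frobenius inner product of two square real matrices. -/
noncomputable def frob {N : ℕ} (A B : Matrix (Fin N) (Fin N) ℝ) : ℝ :=
  ∑ i, ∑ j, A i j * B i j

/-- Spectral decomposition of a real positive definite matrix by an orthogonal matrix. -/
theorem Matrix.PosDef.exists_orthogonal_diagonal {n : Type*} [Fintype n] [DecidableEq n]
    {A : Matrix n n ℝ} (hA : A.PosDef) :
    ∃ (U : Matrix n n ℝ) (d : n → ℝ), (∀ i, 0 < d i) ∧ U * Uᵀ = 1 ∧ A = U * diagonal d * Uᵀ := by
  refine ⟨hA.1.eigenvectorUnitary, hA.1.eigenvalues, hA.eigenvalues_pos, ?_, ?_⟩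
  · have h := Unitary.mul_star_self_of_mem hA.1.eigenvectorUnitary.2
    rwa [star_eq_conjTranspose, conjTranspose_eq_transpose_of_trivial] at h
  · have h := hA.1.spectral_theorem
    rw [Unitary.conjStarAlgAut_apply, star_eq_conjTranspose,
      conjTranspose_eq_transpose_of_trivial] at h
    exact h

/-- Simultaneous diagonalization by congruence of two positive definite matrices. -/
theorem Matrix.PosDef.exists_congruence_diagonal {n : Type*} [Fintype n] [DecidableEq n]
    {X Y : Matrix n n ℝ} (hX : X.PosDef) (hY : Y.PosDef) :
    ∃ (P : Matrix n n ℝ) (d : n → ℝ),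
      (∀ i, 0 < d i) ∧ P.det ≠ 0 ∧ X = P * Pᵀ ∧ Y = P * diagonal d * Pᵀ := by
  obtain ⟨U, e, he, hU, rfl⟩ := hX.exists_orthogonal_diagonal
  obtain ⟨S, hSS⟩ : ∃ S : Matrix n n ℝ, U * diagonal e * Uᵀ = S * Sᵀ := by
    refine ⟨U * diagonal fun i => √(e i), ?_⟩
    rw [transpose_mul, diagonal_transpose, Matrix.mul_assoc U (diagonal _) (_ * _),
      ← Matrix.mul_assoc (diagonal _) (diagonal _), diagonal_mul_diagonal, Matrix.mul_assoc]
    simp only [Real.mul_self_sqrt (he _).le]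
  have hSu : IsUnit S := by
    have h := hX.isUnit
    rw [hSS] at h
    rw [isUnit_iff_isUnit_det] at h ⊢
    rw [det_mul] at h
    exact isUnit_of_mul_isUnit_left h
  have hSd : IsUnit S.det := (isUnit_iff_isUnit_det S).1 hSu
  have hZ : (S⁻¹ * Y * S⁻¹ᵀ).PosDef := by
    rw [← conjTranspose_eq_transpose_of_trivial]
    refine hY.mul_mul_conjTranspose_same ?_
    rw [vecMul_injective_iff_isUnit, isUnit_nonsing_inv_iff]
    exact hSu
  obtain ⟨V, d, hd, hV, hVd⟩ := hZ.exists_orthogonal_diagonal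
  have hVdet : V.det ≠ 0 := by
    intro h
    have := congrArg det hV
    simp [h] at this
  refine ⟨S * V, d, hd, ?_, ?_, ?_⟩
  · rw [det_mul]
    exact mul_ne_zero hSd.ne_zero hVdet
  · rw [hSS, transpose_mul, Matrix.mul_assoc, ← Matrix.mul_assoc V, hV, Matrix.one_mul]
  · calc Y = S * (S⁻¹ * Y * S⁻¹ᵀ) * Sᵀ := by
          rw [Matrix.mul_assoc, Matrix.mul_assoc _ S⁻¹ᵀ, ← transpose_mul,
            mul_nonsing_inv _ hSd, transpose_one, Matrix.mul_one, ← Matrix.mul_assoc,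
            mul_nonsing_inv _ hSd, Matrix.one_mul]
      _ = _ := by
          rw [hVd, transpose_mul]
          simp only [Matrix.mul_assoc]

theorem log_det_congruence_diagonal {n : Type*} [Fintype n] [DecidableEq n]
    {P : Matrix n n ℝ} (hP : P.det ≠ 0) {d : n → ℝ} (hd : ∀ i, 0 < d i) :
    Real.log (P * diagonal d * Pᵀ).det = Real.log (P.det ^ 2) + ∑ i, Real.log (d i) := by
  rw [det_mul, det_mul, det_transpose, det_diagonal, mul_right_comm, ← sq,
    Real.log_mul (pow_ne_zero 2 hP) (prod_ne_zero_iff.2 fun i _ => (hd i).ne'),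
    Real.log_prod fun i _ => (hd i).ne']

theorem log_det_add_smul_one_bounds {n : Type*} [Fintype n] [DecidableEq n]
    {A : Matrix n n ℝ} (hA : A.PosDef) {ε : ℝ} (hε : 0 < ε) :
    Fintype.card n * Real.log ε ≤ Real.log (A + ε • (1 : Matrix n n ℝ)).det ∧
    Real.log (A + ε • (1 : Matrix n n ℝ)).det ≤ Fintype.card n * Real.log ε + A.trace / ε := by
  obtain ⟨U, d, hd, hU, hUd⟩ := hA.exists_orthogonal_diagonal
  have hU2 : U.det ^ 2 = 1 := by
    have := congrArg det hU
    rwa [det_mul, det_transpose, det_one, ← sq] at this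
  have hU0 : U.det ≠ 0 := fun h => by simp [h] at hU2
  have hsum : A + ε • (1 : Matrix n n ℝ) = U * diagonal (fun i => d i + ε) * Uᵀ := by
    have : diagonal (fun i => d i + ε) = diagonal d + ε • (1 : Matrix n n ℝ) := by
      rw [smul_one_eq_diagonal, diagonal_add]
    rw [this, Matrix.mul_add, Matrix.add_mul, ← hUd, mul_smul_comm, Matrix.mul_one,
      smul_mul_assoc, hU]
  have htr : A.trace = ∑ i, d i := by
    rw [hUd, trace_mul_comm, ← Matrix.mul_assoc, mul_eq_one_comm.1 hU, Matrix.one_mul,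
      trace_diagonal]
  rw [hsum, log_det_congruence_diagonal hU0 fun i => add_pos (hd i) hε, hU2, Real.log_one, zero_add,
    htr]
  constructor
  · rw [← nsmul_eq_mul]
    exact card_nsmul_le_sum _ _ _ fun i _ => Real.log_le_log hε (by linarith [hd i])
  · have hle : ∀ i, Real.log (d i + ε) ≤ Real.log ε + d i / ε := fun i => by
      have h1 : d i + ε = ε * (d i / ε + 1) := by field_simp
      have h2 : 0 < d i / ε := div_pos (hd i) hε
      rw [h1, Real.log_mul hε.ne' (by positivity)]
      linarith [Real.log_le_sub_one_of_pos (show 0 < d i / ε + 1 by positivity)]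
    calc ∑ i, Real.log (d i + ε) ≤ ∑ i, (Real.log ε + d i / ε) := sum_le_sum fun i _ => hle i
      _ = _ := by rw [sum_add_distrib, ← sum_div]; simp

theorem sq_div_le_two_mul_log_midpoint_sub_log {x : ℝ} (hx : 0 < x) :
    ((x - 1) / (1 + x)) ^ 2 ≤ 2 * Real.log ((1 + x) / 2) - Real.log x := by
  have h := Real.log_le_sub_one_of_pos (show 0 < x / ((1 + x) / 2) ^ 2 by positivity)
  rw [Real.log_div hx.ne' (by positivity), Real.log_pow] at h
  have h2 : x / ((1 + x) / 2) ^ 2 - 1 = -((x - 1) / (1 + x)) ^ 2 := by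
    field_simp
    ring
  push_cast at h
  linarith

theorem sq_sum_sub_one_mul_le {n : Type*} [Fintype n] {d m : n → ℝ} {G : ℝ}
    (hd : ∀ i, 0 < d i) (hm : ∀ i, 0 ≤ m i) (h1 : ∑ i, m i ≤ G) (h2 : ∑ i, d i * m i ≤ G) :
    (∑ i, (d i - 1) * m i) ^ 2
      ≤ 4 * G ^ 2 * ∑ i, (2 * Real.log ((1 + d i) / 2) - Real.log (d i)) := by
  have hpos : ∀ i, 0 ≤ (1 + d i) * m i := fun i => mul_nonneg (by linarith [hd i]) (hm i)
  have hsum : ∑ i, (1 + d i) * m i ≤ 2 * G := by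
    simp only [add_mul, one_mul, sum_add_distrib]
    linarith
  have hsq : ∑ i, ((1 + d i) * m i) ^ 2 ≤ 4 * G ^ 2 := by
    calc ∑ i, ((1 + d i) * m i) ^ 2 ≤ (∑ i, (1 + d i) * m i) ^ 2 :=
          sum_sq_le_sq_sum_of_nonneg fun i _ => hpos i
      _ ≤ (2 * G) ^ 2 := pow_le_pow_left₀ (sum_nonneg fun i _ => hpos i) hsum 2
      _ = 4 * G ^ 2 := by ring
  have heq : ∑ i, (d i - 1) * m i = ∑ i, ((1 + d i) * m i) * ((d i - 1) / (1 + d i)) :=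
    sum_congr rfl fun i _ => by
      have : 1 + d i ≠ 0 := by linarith [hd i]
      field_simp
  rw [heq]
  refine (sum_mul_sq_le_sq_mul_sq _ _ _).trans (mul_le_mul hsq ?_ ?_ (by positivity))
  · exact sum_le_sum fun i _ => sq_div_le_two_mul_log_midpoint_sub_log (hd i)
  · exact sum_nonneg fun i _ => sq_nonneg _

/-- Midpoint strong concavity of `log det` in directions measured by a positive semidefinite
matrix. -/
theorem sq_trace_sub_mul_le_log_det_midpoint {n : Type*} [Fintype n] [DecidableEq n]
    {X Y M : Matrix n n ℝ} (hX : X.PosDef) (hY : Y.PosDef) (hM : M.PosSemidef) {G : ℝ}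
    (hXM : (X * M).trace ≤ G) (hYM : (Y * M).trace ≤ G) :
    ((Y - X) * M).trace ^ 2 ≤ 4 * G ^ 2 *
      (2 * Real.log ((1 / 2 : ℝ) • (X + Y)).det - Real.log X.det - Real.log Y.det) := by
  obtain ⟨P, d, hd, hP, hXP, hYP⟩ := hX.exists_congruence_diagonal hY
  have hXP' : X = P * diagonal (fun _ => 1) * Pᵀ := by
    rw [diagonal_one, Matrix.mul_one, hXP]
  have hmid : (1 / 2 : ℝ) • (X + Y) = P * diagonal (fun i => (1 + d i) / 2) * Pᵀ := by
    have : diagonal (fun i => (1 + d i) / 2)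
        = (1 / 2 : ℝ) • (diagonal (fun _ => 1) + diagonal d) := by
      rw [diagonal_add, ← diagonal_smul]
      congr 1
      ext i
      simp only [Pi.smul_apply, smul_eq_mul]
      ring
    rw [this, mul_smul_comm, smul_mul_assoc, Matrix.mul_add, Matrix.add_mul, ← hXP', ← hYP]
  have htr : ∀ e : n → ℝ, (P * diagonal e * Pᵀ * M).trace
      = ∑ i, e i * (Pᵀ * M * P) i i := fun e => by
    rw [Matrix.mul_assoc, Matrix.mul_assoc, trace_mul_comm, Matrix.mul_assoc]
    simp [trace, diagonal_mul]
  have hpsd : (Pᵀ * M * P).PosSemidef := by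
    rw [← conjTranspose_eq_transpose_of_trivial]
    exact hM.conjTranspose_mul_mul_same P
  have hXs : (X * M).trace = ∑ i, (Pᵀ * M * P) i i := by
    rw [hXP', htr]
    simp
  have hYs : (Y * M).trace = ∑ i, d i * (Pᵀ * M * P) i i := by rw [hYP, htr]
  have hlog : 2 * Real.log ((1 / 2 : ℝ) • (X + Y)).det - Real.log X.det - Real.log Y.det
      = ∑ i, (2 * Real.log ((1 + d i) / 2) - Real.log (d i)) := by
    rw [hmid, hYP, hXP', log_det_congruence_diagonal hP fun i => by linarith [hd i],
      log_det_congruence_diagonal hP hd, log_det_congruence_diagonal hP fun _ => one_pos,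
      sum_sub_distrib, ← mul_sum]
    simp only [Real.log_one, sum_const_zero]
    ring
  have hdiff : ((Y - X) * M).trace = ∑ i, (d i - 1) * (Pᵀ * M * P) i i := by
    rw [Matrix.sub_mul, trace_sub, hXs, hYs, ← sum_sub_distrib]
    exact sum_congr rfl fun i _ => by ring
  rw [hlog, hdiff]
  exact sq_sum_sub_one_mul_le hd (fun i => hpsd.diag_nonneg) (hXs ▸ hXM) (hYs ▸ hYM)

theorem frob_comm {N : ℕ} (A B : Matrix (Fin N) (Fin N) ℝ) : frob A B = frob B A := by
  simp only [frob, mul_comm]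

theorem frob_add_left {N : ℕ} (A B C : Matrix (Fin N) (Fin N) ℝ) :
    frob (A + B) C = frob A C + frob B C := by
  simp only [frob, Matrix.add_apply, add_mul, sum_add_distrib]

theorem frob_sub_left {N : ℕ} (A B C : Matrix (Fin N) (Fin N) ℝ) :
    frob (A - B) C = frob A C - frob B C := by
  simp only [frob, Matrix.sub_apply, sub_mul, sum_sub_distrib]

theorem frob_smul_left {N : ℕ} (c : ℝ) (A B : Matrix (Fin N) (Fin N) ℝ) :
    frob (c • A) B = c * frob A B := by
  simp only [frob, Matrix.smul_apply, smul_eq_mul, mul_sum, mul_assoc]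

theorem frob_eq_trace {N : ℕ} (A : Matrix (Fin N) (Fin N) ℝ) {B : Matrix (Fin N) (Fin N) ℝ}
    (hB : B.IsHermitian) : frob A B = (A * B).trace := by
  simp only [frob, trace, diag_apply, mul_apply]
  refine sum_congr rfl fun i _ => sum_congr rfl fun j _ => ?_
  rw [← hB.apply i j, star_trivial]

theorem frob_le_of_abs_le {N : ℕ} {A B : Matrix (Fin N) (Fin N) ℝ} {a b : ℝ} (ha : 0 ≤ a)
    (hA : ∀ i j, |A i j| ≤ a) (hB : ∑ i, ∑ j, |B i j| ≤ b) : frob A B ≤ b * a := by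
  calc frob A B ≤ ∑ i, ∑ j, |B i j| * a := by
        refine sum_le_sum fun i _ => sum_le_sum fun j _ => (le_abs_self _).trans ?_
        rw [abs_mul, mul_comm]
        exact mul_le_mul_of_nonneg_left (hA i j) (abs_nonneg _)
    _ = (∑ i, ∑ j, |B i j|) * a := by simp only [sum_mul]
    _ ≤ b * a := mul_le_mul_of_nonneg_right hB ha

/-- Regret bound for follow-the-regularized-leader: if playing `w t` instead of any competitor costs
at most `c` in the regularized objective that includes round `t`, the regularized regret is at most
`T * c`. -/
theorem ftrl_regret {α : Type*} {T : ℕ} (hT : 0 < T) (K : Set α) (F : α → ℝ) (ℓ : Fin T → α → ℝ)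
    (w : Fin T → α) (hw : ∀ t, w t ∈ K) (c : ℝ)
    (hmin : ∀ v ∈ K, F (w ⟨0, hT⟩) ≤ F v)
    (hstab : ∀ t, ∀ v ∈ K, F (w t) + ∑ s ∈ univ.filter (· < t), ℓ s (w t) + ℓ t (w t) - c
      ≤ F v + ∑ s ∈ univ.filter (· < t), ℓ s v + ℓ t v) {v : α} (hv : v ∈ K) :
    F (w ⟨0, hT⟩) + ∑ t, ℓ t (w t) - T * c ≤ F v + ∑ t, ℓ t v := by
  have key : ∀ k : ℕ, k ≤ T → ∀ v ∈ K,
      F (w ⟨0, hT⟩) + ∑ s ∈ univ.filter (fun s : Fin T => s.1 < k), ℓ s (w s) - k * c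
        ≤ F v + ∑ s ∈ univ.filter (fun s : Fin T => s.1 < k), ℓ s v := by
    intro k
    induction k with
    | zero => simpa using hmin
    | succ k ih =>
      intro hk v hv
      have hfil : univ.filter (fun s : Fin T => s.1 < k + 1)
          = insert ⟨k, hk⟩ (univ.filter fun s : Fin T => s.1 < k) := by
        ext s
        simp only [mem_filter, mem_univ, true_and, mem_insert, Fin.ext_iff]
        omega
      have h1 := ih (by omega) _ (hw ⟨k, hk⟩)
      have h2 := hstab ⟨k, hk⟩ v hv
      simp only [Fin.lt_def] at h2
      rw [hfil, sum_insert (by simp), sum_insert (by simp)]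
      push_cast
      linarith
  have h := key T le_rfl v hv
  simpa using h

theorem trace_conj_add_mul_conj_inv {N : ℕ} {Γ L : Matrix (Fin N) (Fin N) ℝ} (hΓ : IsUnit Γ.det)
    (hL : L.IsHermitian) (A : Matrix (Fin N) (Fin N) ℝ) (ε : ℝ) :
    ((Γ * A * Γ + ε • (1 : Matrix (Fin N) (Fin N) ℝ)) * (Γ⁻¹ * L * Γ⁻¹)).trace
      = frob (A + ε • (Γ⁻¹ * Γ⁻¹)) L := by
  have h1 : Γ * A * Γ + ε • (1 : Matrix (Fin N) (Fin N) ℝ)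
      = Γ * ((A + ε • (Γ⁻¹ * Γ⁻¹)) * Γ) := by
    rw [Matrix.add_mul, Matrix.mul_add, smul_mul_assoc, mul_smul_comm, Matrix.mul_assoc Γ⁻¹,
      nonsing_inv_mul _ hΓ, Matrix.mul_one, mul_nonsing_inv _ hΓ, Matrix.mul_assoc]
  have h2 : Γ * ((A + ε • (Γ⁻¹ * Γ⁻¹)) * Γ) * (Γ⁻¹ * L * Γ⁻¹)
      = Γ * ((A + ε • (Γ⁻¹ * Γ⁻¹)) * L * Γ⁻¹) := by
    rw [Matrix.mul_assoc, Matrix.mul_assoc _ Γ, Matrix.mul_assoc Γ⁻¹ L,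
      mul_nonsing_inv_cancel_left _ _ hΓ, Matrix.mul_assoc _ L]
  rw [frob_eq_trace _ hL, h1, h2, trace_mul_comm, nonsing_inv_mul_cancel_right _ _ hΓ]

theorem posDef_mul_mul_self {N : ℕ} {Γ W : Matrix (Fin N) (Fin N) ℝ} (hΓ : Γ.PosDef)
    (hW : W.PosDef) : (Γ * W * Γ).PosDef := by
  have h := hW.mul_mul_conjTranspose_same (B := Γ) (vecMul_injective_iff_isUnit.2 hΓ.isUnit)
  rwa [hΓ.1.eq] at h

/-- Midpoint strong concavity of `W ↦ log det (Γ * W * Γ + ε • 1)` in the direction of a loss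
matrix, over matrices with bounded entries. -/
theorem sq_frob_sub_le_log_det_midpoint {N : ℕ} {Γ L W V : Matrix (Fin N) (Fin N) ℝ}
    (hΓ : Γ.PosDef) (hW : W.PosDef) (hV : V.PosDef) (hL : L.PosSemidef) {β ρ g ε : ℝ} (hε : 0 < ε)
    (hβρ : 0 ≤ β + ρ * ε) (hρ : ∀ i j, |(Γ⁻¹ * Γ⁻¹) i j| ≤ ρ) (hWβ : ∀ i j, |W i j| ≤ β)
    (hVβ : ∀ i j, |V i j| ≤ β) (hLg : ∑ i, ∑ j, |L i j| ≤ g) :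
    frob (V - W) L ^ 2 ≤ 4 * (g * (β + ρ * ε)) ^ 2 *
      (2 * Real.log (Γ * ((1 / 2 : ℝ) • (W + V)) * Γ + ε • (1 : Matrix (Fin N) (Fin N) ℝ)).det
        - Real.log (Γ * W * Γ + ε • (1 : Matrix (Fin N) (Fin N) ℝ)).det
        - Real.log (Γ * V * Γ + ε • (1 : Matrix (Fin N) (Fin N) ℝ)).det) := by
  have hΓu : IsUnit Γ.det := (isUnit_iff_isUnit_det Γ).1 hΓ.isUnit
  have hε1 : (ε • (1 : Matrix (Fin N) (Fin N) ℝ)).PosDef := PosDef.one.smul hε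
  have hM : (Γ⁻¹ * L * Γ⁻¹).PosSemidef := by
    have h := hL.mul_mul_conjTranspose_same Γ⁻¹
    rwa [hΓ.inv.1.eq] at h
  have hbound : ∀ A : Matrix (Fin N) (Fin N) ℝ, (∀ i j, |A i j| ≤ β) →
      ((Γ * A * Γ + ε • (1 : Matrix (Fin N) (Fin N) ℝ)) * (Γ⁻¹ * L * Γ⁻¹)).trace
        ≤ g * (β + ρ * ε) := fun A hA => by
    rw [trace_conj_add_mul_conj_inv hΓu hL.1]
    refine frob_le_of_abs_le hβρ (fun i j => ?_) hLg
    rw [Matrix.add_apply, Matrix.smul_apply, smul_eq_mul]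
    refine (abs_add_le _ _).trans (add_le_add (hA i j) ?_)
    rw [abs_mul, abs_of_pos hε, mul_comm]
    exact mul_le_mul_of_nonneg_right (hρ i j) hε.le
  have h := sq_trace_sub_mul_le_log_det_midpoint ((posDef_mul_mul_self hΓ hW).add hε1)
    ((posDef_mul_mul_self hΓ hV).add hε1) hM (hbound W hWβ) (hbound V hVβ)
  have hdiff : frob (V - W) L = ((Γ * V * Γ + ε • (1 : Matrix (Fin N) (Fin N) ℝ)
      - (Γ * W * Γ + ε • (1 : Matrix (Fin N) (Fin N) ℝ))) * (Γ⁻¹ * L * Γ⁻¹)).trace := by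
    rw [Matrix.sub_mul, trace_sub, trace_conj_add_mul_conj_inv hΓu hL.1,
      trace_conj_add_mul_conj_inv hΓu hL.1, ← frob_sub_left, add_sub_add_right_eq_sub]
  have hmid : Γ * ((1 / 2 : ℝ) • (W + V)) * Γ + ε • (1 : Matrix (Fin N) (Fin N) ℝ)
      = (1 / 2 : ℝ) • (Γ * W * Γ + ε • (1 : Matrix (Fin N) (Fin N) ℝ)
        + (Γ * V * Γ + ε • (1 : Matrix (Fin N) (Fin N) ℝ))) := by
    rw [mul_smul_comm, smul_mul_assoc, Matrix.mul_add, Matrix.add_mul]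
    module
  rw [hdiff, hmid]
  exact h

/-- The set of feasible matrices is closed under midpoints. -/
theorem feasible_midpoint {N : ℕ} {Γ W V : Matrix (Fin N) (Fin N) ℝ} {β τ : ℝ}
    (hW : W.PosDef ∧ (∀ i j, |W i j| ≤ β) ∧ (Γ * W * Γ).trace ≤ τ)
    (hV : V.PosDef ∧ (∀ i j, |V i j| ≤ β) ∧ (Γ * V * Γ).trace ≤ τ) :
    ((1 / 2 : ℝ) • (W + V)).PosDef ∧ (∀ i j, |((1 / 2 : ℝ) • (W + V)) i j| ≤ β) ∧
      (Γ * ((1 / 2 : ℝ) • (W + V)) * Γ).trace ≤ τ := by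
  refine ⟨(hW.1.add hV.1).smul (by norm_num), fun i j => ?_, ?_⟩
  · have h1 := abs_le.1 (hW.2.1 i j)
    have h2 := abs_le.1 (hV.2.1 i j)
    rw [Matrix.smul_apply, Matrix.add_apply, smul_eq_mul, abs_le]
    constructor <;> linarith
  · rw [mul_smul_comm, smul_mul_assoc, Matrix.mul_add, Matrix.add_mul, trace_smul, trace_add,
      smul_eq_mul]
    linarith [hW.2.2, hV.2.2]

theorem stmt1 (N T : ℕ) (hN : 0 < N) (hT : 0 < T)
    (Γ : Matrix (Fin N) (Fin N) ℝ) (hΓ : Γ.PosDef)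
    (β τ g ε η ρ : ℝ) (hβ : 0 < β) (hτ : 0 < τ) (hg : 0 < g) (hε : 0 < ε)
    (hρ : ρ = ⨆ i, ⨆ j, |(Γ⁻¹ * Γ⁻¹) i j|)
    (hη : η = Real.sqrt (τ / (g ^ 2 * (β + ρ * ε) ^ 2 * ε * T)))
    (K : Set (Matrix (Fin N) (Fin N) ℝ))
    (hK : K = {W | W.PosDef ∧ (∀ i j, |W i j| ≤ β) ∧ (Γ * W * Γ).trace ≤ τ})
    (L W : Fin T → Matrix (Fin N) (Fin N) ℝ)
    (hL : ∀ t, (L t).PosSemidef ∧ (∑ i, ∑ j, |L t i j|) ≤ g)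
    (hW : ∀ t, W t ∈ K ∧ ∀ V ∈ K,
      (- Real.log ((Γ * W t * Γ + ε • (1 : Matrix (Fin N) (Fin N) ℝ)).det)
        + η * ∑ s ∈ Finset.univ.filter (fun s => s < t), frob (L s) (W t))
      ≤ (- Real.log ((Γ * V * Γ + ε • (1 : Matrix (Fin N) (Fin N) ℝ)).det)
        + η * ∑ s ∈ Finset.univ.filter (fun s => s < t), frob (L s) V))
    (Wstar : Matrix (Fin N) (Fin N) ℝ) (hWstar : Wstar ∈ K) :
    ∑ t, frob (W t - Wstar) (L t)
      ≤ (1 + 1152 * Real.sqrt (Real.exp 1)) * g * (β + ρ * ε) * Real.sqrt (τ * T / ε) := by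
  subst hK
  have hρle : ∀ i j, |(Γ⁻¹ * Γ⁻¹) i j| ≤ ρ := fun i j => by
    rw [hρ]
    exact (le_ciSup (f := fun j => |(Γ⁻¹ * Γ⁻¹) i j|) (Set.finite_range _).bddAbove j).trans
      (le_ciSup (f := fun i => ⨆ j, |(Γ⁻¹ * Γ⁻¹) i j|) (Set.finite_range _).bddAbove i)
  have hρ0 : 0 ≤ ρ := (abs_nonneg _).trans (hρle ⟨0, hN⟩ ⟨0, hN⟩)
  have hβρ : 0 < β + ρ * ε := by positivity
  have hTpos : (0 : ℝ) < T := Nat.cast_pos.2 hT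
  set G := g * (β + ρ * ε) with hG
  have hG0 : 0 < G := mul_pos hg hβρ
  have hη0 : 0 < η := by rw [hη]; positivity
  have hη2 : η ^ 2 * G ^ 2 * T = τ / ε := by
    rw [hη, Real.sq_sqrt (by positivity), hG]
    field_simp
  have hreg := ftrl_regret hT {W | W.PosDef ∧ (∀ i j, |W i j| ≤ β) ∧ (Γ * W * Γ).trace ≤ τ}
    (fun V => - Real.log (Γ * V * Γ + ε • (1 : Matrix (Fin N) (Fin N) ℝ)).det)
    (fun t V => η * frob (L t) V) W (fun t => (hW t).1) (η ^ 2 * G ^ 2)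
    (fun V hV => by
      have h := (hW ⟨0, hT⟩).2 V hV
      simpa [Fin.lt_def] using h)
    (fun t V hV => by
      have hmin := (hW t).2 _ (feasible_midpoint (hW t).1 hV)
      have hconc := sq_frob_sub_le_log_det_midpoint hΓ (hW t).1.1 hV.1 (hL t).1 hε hβρ.le hρle
        (hW t).1.2.1 hV.2.1 (hL t).2
      have hlin : ∑ s ∈ univ.filter (fun s => s < t), frob (L s) ((1 / 2 : ℝ) • (W t + V))
          = 1 / 2 * (∑ s ∈ univ.filter (fun s => s < t), frob (L s) (W t)
            + ∑ s ∈ univ.filter (fun s => s < t), frob (L s) V) := by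
        rw [← sum_add_distrib, mul_sum]
        refine sum_congr rfl fun s _ => ?_
        rw [frob_comm, frob_smul_left, frob_add_left, frob_comm, frob_comm V]
      rw [hlin] at hmin
      rw [← hG, frob_sub_left, frob_comm V, frob_comm (W t)] at hconc
      simp only [← mul_sum]
      have hG2 : 0 < 4 * G ^ 2 := by positivity
      rw [← sub_nonneg]
      refine nonneg_of_mul_nonneg_right (?_ : 0 ≤ 4 * G ^ 2 * _) hG2
      have hstep := mul_le_mul_of_nonneg_left hmin hG2.le
      nlinarith [sq_nonneg (frob (L t) V - frob (L t) (W t) + 2 * G ^ 2 * η)])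
    hWstar
  simp only [← mul_sum] at hreg
  have hlow := (log_det_add_smul_one_bounds (posDef_mul_mul_self hΓ hWstar.1) hε).1
  have hupp := (log_det_add_smul_one_bounds
    (posDef_mul_mul_self hΓ (hW ⟨0, hT⟩).1.1) hε).2
  have htr : (Γ * W ⟨0, hT⟩ * Γ).trace / ε ≤ τ / ε :=
    div_le_div_of_nonneg_right (hW ⟨0, hT⟩).1.2.2 hε.le
  have hsum : ∑ t, frob (W t - Wstar) (L t)
      = ∑ t, frob (L t) (W t) - ∑ t, frob (L t) Wstar := by
    rw [← sum_sub_distrib]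
    exact sum_congr rfl fun t _ => by rw [frob_sub_left, frob_comm, frob_comm Wstar]
  have hηR : η * ∑ t, frob (W t - Wstar) (L t) ≤ 2 * (τ / ε) := by
    rw [hsum]
    linarith
  have hηQ : η * (G * √(τ * T / ε)) = τ / ε := by
    refine (pow_left_inj₀ (by positivity) (by positivity) two_ne_zero).1 ?_
    rw [mul_pow, mul_pow, Real.sq_sqrt (by positivity), ← mul_assoc]
    calc η ^ 2 * G ^ 2 * (τ * T / ε) = η ^ 2 * G ^ 2 * T * (τ / ε) := by ring
      _ = (τ / ε) ^ 2 := by rw [hη2, sq]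
  have hR : ∑ t, frob (W t - Wstar) (L t) ≤ 2 * (G * √(τ * T / ε)) :=
    le_of_mul_le_mul_left (by linarith) hη0
  have he : 1 ≤ √(Real.exp 1) := Real.one_le_sqrt.2 (Real.one_le_exp zero_le_one)
  calc ∑ t, frob (W t - Wstar) (L t) ≤ 2 * (G * √(τ * T / ε)) := hR
    _ ≤ (1 + 1152 * √(Real.exp 1)) * (G * √(τ * T / ε)) :=
        mul_le_mul_of_nonneg_right (by linarith) (by positivity)
    _ = _ := by rw [hG]; ring
end

section
/- Let N, T be positive integers, let K be a convex set of symmetric N×N real matrices, let 𝓛 be a set of N×N real matrices, let s > 0 and η > 0, and let R : K → ℝ be s-strongly convex with respect to 𝓛 for K. Let H₀ ≥ 0 be such that R(W) − R(W') ≤ H₀ for all W, W' ∈ K. Suppose L_1, …, L_T ∈ 𝓛 and W_1, …, W_T ∈ K are such that for each t ∈ [T], W_t minimises W ↦ R(W) + η ∑_{s'=1}^{t−1} L_{s'} • W over K. Then for every W* ∈ K, ∑_{t=1}^{T} (W_t − W*) • L_t ≤ H₀/η + η T / s. -/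
open Finset Matrix

theorem frob_add_right {N : ℕ} (A B C : Matrix (Fin N) (Fin N) ℝ) :
    frob A (B + C) = frob A B + frob A C := by
  simp [frob, mul_add, Finset.sum_add_distrib]

theorem frob_sub_right {N : ℕ} (A B C : Matrix (Fin N) (Fin N) ℝ) :
    frob A (B - C) = frob A B - frob A C := by
  simp [frob, mul_sub, Finset.sum_sub_distrib]

theorem frob_smul_right {N : ℕ} (A B : Matrix (Fin N) (Fin N) ℝ) (c : ℝ) :
    frob A (c • B) = c * frob A B := by
  simp [frob, Finset.mul_sum, mul_left_comm]

theorem Fin.sum_filter_val_lt_succ {T : ℕ} (t : Fin T) (f : Fin T → ℝ) :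
    ∑ u ∈ Finset.univ.filter (fun u : Fin T => (u : ℕ) < t + 1), f u
      = f t + ∑ u ∈ Finset.univ.filter (fun u => u < t), f u := by
  rw [← Finset.sum_insert (by simp)]
  congr 1
  ext u
  simp [Order.lt_add_one_iff, le_iff_eq_or_lt, Fin.ext_iff]

/-- A minimiser of a strongly convex function plus a linear functional beats every other point
by a quadratic margin. -/
theorem quadratic_growth_of_minimizer {N : ℕ} {K : Set (Matrix (Fin N) (Fin N) ℝ)}
    (hK : Convex ℝ K) {L : Matrix (Fin N) (Fin N) ℝ} {s η : ℝ}
    {R : Matrix (Fin N) (Fin N) ℝ → ℝ}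
    (hR : ∀ α ∈ Set.Icc (0 : ℝ) 1, ∀ X ∈ K, ∀ Y ∈ K,
      R (α • X + (1 - α) • Y)
        ≤ α * R X + (1 - α) * R Y - s / 2 * α * (1 - α) * (frob L (X - Y)) ^ 2)
    {ι : Type*} (S : Finset ι) (M : ι → Matrix (Fin N) (Fin N) ℝ)
    {W : Matrix (Fin N) (Fin N) ℝ} (hW : W ∈ K)
    (hmin : ∀ V ∈ K, R W + η * ∑ u ∈ S, frob (M u) W ≤ R V + η * ∑ u ∈ S, frob (M u) V)
    {V : Matrix (Fin N) (Fin N) ℝ} (hV : V ∈ K) :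
    R W + η * ∑ u ∈ S, frob (M u) W + s / 4 * (frob L (V - W)) ^ 2
      ≤ R V + η * ∑ u ∈ S, frob (M u) V := by
  have hmid := hmin _ (hK hV hW (a := 1 / 2) (b := 1 - 1 / 2)
    (by norm_num) (by norm_num) (by norm_num))
  have hconv := hR (1 / 2) (by norm_num) V hV W hW
  simp only [frob_add_right, frob_smul_right, Finset.sum_add_distrib, ← Finset.mul_sum] at hmid
  linarith

theorem stmt11 (N T : ℕ) (hN : 0 < N) (hT : 0 < T)
    (K : Set (Matrix (Fin N) (Fin N) ℝ)) (hKconv : Convex ℝ K)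
    (hKsym : ∀ W ∈ K, Wᵀ = W)
    (Lset : Set (Matrix (Fin N) (Fin N) ℝ))
    (s η : ℝ) (hs : 0 < s) (hη : 0 < η)
    (R : Matrix (Fin N) (Fin N) ℝ → ℝ)
    (hR : ∀ α ∈ Set.Icc (0 : ℝ) 1, ∀ X ∈ K, ∀ Y ∈ K, ∀ L ∈ Lset,
      R (α • X + (1 - α) • Y)
        ≤ α * R X + (1 - α) * R Y - s / 2 * α * (1 - α) * (frob L (X - Y)) ^ 2)
    (H₀ : ℝ) (hH₀ : 0 ≤ H₀) (hdiam : ∀ W ∈ K, ∀ W' ∈ K, R W - R W' ≤ H₀)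
    (L W : Fin T → Matrix (Fin N) (Fin N) ℝ)
    (hL : ∀ t, L t ∈ Lset)
    (hW : ∀ t, W t ∈ K ∧ ∀ V ∈ K,
      R (W t) + η * ∑ s' ∈ Finset.univ.filter (fun s' => s' < t), frob (L s') (W t)
      ≤ R V + η * ∑ s' ∈ Finset.univ.filter (fun s' => s' < t), frob (L s') V)
    (Wstar : Matrix (Fin N) (Fin N) ℝ) (hWstar : Wstar ∈ K) :
    ∑ t, frob (W t - Wstar) (L t) ≤ H₀ / η + η * T / s := by
  have key : ∀ n ≤ T, ∀ V ∈ K,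
      R Wstar - H₀ + η * ∑ u ∈ Finset.univ.filter (fun u : Fin T => (u : ℕ) < n),
          frob (L u) (W u) - n * (η ^ 2 / s)
        ≤ R V + η * ∑ u ∈ Finset.univ.filter (fun u : Fin T => (u : ℕ) < n),
          frob (L u) V := by
    intro n
    induction n with
    | zero =>
      intro _ V hV
      have := hdiam Wstar hWstar V hV
      simp
      linarith
    | succ n ih =>
      intro hn V hV
      let t : Fin T := ⟨n, hn⟩
      have hprev := ih (by omega) (W t) (hW t).1
      have hgrow := quadratic_growth_of_minimizer hKconv (L := L t)
        (fun α hα X hX Y hY => hR α hα X hX Y hY (L t) (hL t)) _ L (hW t).1 (hW t).2 hV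
      have hsquare : 0 ≤ s / 4 * (frob (L t) (V - W t)) ^ 2
          + η * frob (L t) (V - W t) + η ^ 2 / s := by
        have : s / 4 * (frob (L t) (V - W t)) ^ 2 + η * frob (L t) (V - W t) + η ^ 2 / s
            = (s * frob (L t) (V - W t) + 2 * η) ^ 2 / (4 * s) := by
          field_simp
          ring
        rw [this]
        positivity
      have hsum := Fin.sum_filter_val_lt_succ t
      change ∀ f : Fin T → ℝ, ∑ u ∈ Finset.univ.filter (fun u : Fin T => (u : ℕ) < n + 1), f u
        = f t + ∑ u ∈ Finset.univ.filter (fun u : Fin T => (u : ℕ) < n), f u at hsum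
      change R (W t) + η * ∑ u ∈ Finset.univ.filter (fun u : Fin T => (u : ℕ) < n),
          frob (L u) (W t) + s / 4 * (frob (L t) (V - W t)) ^ 2
        ≤ R V + η * ∑ u ∈ Finset.univ.filter (fun u : Fin T => (u : ℕ) < n),
          frob (L u) V at hgrow
      rw [hsum, hsum]
      rw [frob_sub_right] at hgrow hsquare
      push_cast
      linarith
  have hfinal := key T le_rfl Wstar hWstar
  simp only [Fin.is_lt, Finset.filter_true] at hfinal
  simp only [frob_comm _ (L _), frob_sub_right, Finset.sum_sub_distrib]
  have hbound : H₀ / η + η * T / s = (H₀ + T * (η ^ 2 / s)) / η := by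
    field_simp
  rw [hbound, le_div_iff₀ hη]
  linarith
end
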